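/- Let 𝒜 be a symmetric real tensor of order m ≥ 2 and dimension n ≥ 2 such that every proper principal subtensor of 𝒜 is copositive. Then 𝒜 is not copositive if and only if 𝒜 has a negative H⁺⁺-eigenvalue, i.e., there exist λ < 0 and x ∈ ℝⁿ with x > 0 componentwise such that (𝒜x^{m−1})_i = λ x_i^{m−1} for all i. -/

import Mathlib

/-- `(A x^{m-1})_i` for an order-`m = k+2`, dimension-`n` tensor `A`. -/
def tmul {n k : ℕ} (A : (Fin (k + 2) → Fin n) → ℝ) (x : Fin n → ℝ) (i : Fin n) : ℝ :=
  ∑ f : Fin (k + 1) → Fin n, A (Fin.cons i f) * ∏ j, x (f j)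

/-- The homogeneous form `A x^m` of an order-`m = k+2` tensor. -/
def tpow {n k : ℕ} (A : (Fin (k + 2) → Fin n) → ℝ) (x : Fin n → ℝ) : ℝ :=
  ∑ g : Fin (k + 2) → Fin n, A g * ∏ j, x (g j)

/-- `A` is symmetric: invariant under every permutation of the indices. -/
def SymTensor {n k : ℕ} (A : (Fin (k + 2) → Fin n) → ℝ) : Prop :=
  ∀ (g : Fin (k + 2) → Fin n) (σ : Equiv.Perm (Fin (k + 2))), A (g ∘ σ) = A g

/-- `A` is copositive. -/
def Copos {n k : ℕ} (A : (Fin (k + 2) → Fin n) → ℝ) : Prop :=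
  ∀ x : Fin n → ℝ, (∀ i, 0 ≤ x i) → 0 ≤ tpow A x

/-- The principal subtensor of `A` indexed by `J` is copositive. -/
def CoposOn {n k : ℕ} (A : (Fin (k + 2) → Fin n) → ℝ) (J : Finset (Fin n)) : Prop :=
  ∀ x : Fin n → ℝ, (∀ i, 0 ≤ x i) → (∀ i, i ∉ J → x i = 0) → 0 ≤ tpow A x

/-- `A` is almost copositive. -/
def AlmostCopos {n k : ℕ} (A : (Fin (k + 2) → Fin n) → ℝ) : Prop :=
  ¬ Copos A ∧ ∀ J : Finset (Fin n), J.Nonempty → J ≠ Finset.univ → CoposOn A J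

theorem tpow_smul {n k : ℕ} (A : (Fin (k + 2) → Fin n) → ℝ) (c : ℝ) (x : Fin n → ℝ) :
    tpow A (c • x) = c ^ (k + 2) * tpow A x := by
  simp only [tpow, Pi.smul_apply, smul_eq_mul, Finset.prod_mul_distrib, Finset.prod_const,
    Finset.card_univ, Fintype.card_fin, Finset.mul_sum]
  exact Finset.sum_congr rfl fun g _ => by ring

theorem continuous_tpow {n k : ℕ} (A : (Fin (k + 2) → Fin n) → ℝ) : Continuous (tpow A) := by
  unfold tpow
  fun_prop

theorem tpow_eq_sum_mul_tmul {n k : ℕ} (A : (Fin (k + 2) → Fin n) → ℝ) (x : Fin n → ℝ) :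
    tpow A x = ∑ i, x i * tmul A x i := by
  rw [tpow, ← (Fin.consEquiv fun _ : Fin (k + 2) => Fin n).sum_comp, Fintype.sum_prod_type]
  refine Finset.sum_congr rfl fun i _ => ?_
  rw [tmul, Finset.mul_sum]
  refine Finset.sum_congr rfl fun f _ => ?_
  simp [Fin.consEquiv, Fin.prod_univ_succ]
  ring

theorem SymTensor.apply_insertNth {n k : ℕ} {A : (Fin (k + 2) → Fin n) → ℝ} (hA : SymTensor A)
    (j : Fin (k + 2)) (i : Fin n) (f : Fin (k + 1) → Fin n) :
    A (j.insertNth (α := fun _ => Fin n) i f) = A (Fin.cons i f) := by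
  rw [← hA (Fin.cons i f) j.cycleRange, Fin.cons_comp_cycleRange]

theorem hasDerivAt_add_smul_single {n : ℕ} (x : Fin n → ℝ) (i l : Fin n) :
    HasDerivAt (fun t : ℝ => (x + t • Pi.single i (1 : ℝ) : Fin n → ℝ) l)
      ((Pi.single i 1 : Fin n → ℝ) l) 0 := by
  simpa using ((hasDerivAt_id (0 : ℝ)).mul_const ((Pi.single i 1 : Fin n → ℝ) l)).const_add (x l)

/-- Partial derivatives of the form of a symmetric tensor. -/
theorem SymTensor.hasDerivAt_tpow {n k : ℕ} {A : (Fin (k + 2) → Fin n) → ℝ} (hA : SymTensor A)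
    (x : Fin n → ℝ) (i : Fin n) :
    HasDerivAt (fun t : ℝ => tpow A (x + t • Pi.single i 1)) ((k + 2) * tmul A x i) 0 := by
  have hsum : HasDerivAt (fun t : ℝ => tpow A (x + t • Pi.single i 1))
      (∑ g : Fin (k + 2) → Fin n, A g * ∑ j, (∏ l ∈ Finset.univ.erase j, x (g l)) *
        (Pi.single i 1 : Fin n → ℝ) (g j)) 0 := by
    unfold tpow
    refine HasDerivAt.fun_sum fun g _ => HasDerivAt.const_mul _ ?_
    simpa using HasDerivAt.fun_finsetProd (u := Finset.univ) fun j _ =>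
      hasDerivAt_add_smul_single x i (g j)
  convert hsum using 1
  simp only [Finset.mul_sum]
  rw [Finset.sum_comm]
  have hslot (j : Fin (k + 2)) : ∑ g : Fin (k + 2) → Fin n,
      A g * ((∏ l ∈ Finset.univ.erase j, x (g l)) * (Pi.single i 1 : Fin n → ℝ) (g j)) =
        tmul A x i := by
    rw [← (Fin.insertNthEquiv (fun _ : Fin (k + 2) => Fin n) j).sum_comp, Fintype.sum_prod_type,
      Finset.sum_eq_single i]
    · refine Finset.sum_congr rfl fun f _ => ?_
      have herase : Finset.univ.erase j = Finset.univ.image j.succAbove := by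
        rw [Fin.image_succAbove_univ]
        ext; simp
      rw [herase, Finset.prod_image fun a _ b _ h => Fin.succAbove_right_injective h]
      simp [Fin.insertNthEquiv, hA.apply_insertNth]
    · intro b _ hb
      simp [Fin.insertNthEquiv, hb]
    · simp
  simp [hslot]

/-- On the nonnegative orthant, `A x^m / ∑ xᵢ^m` attains its minimum. -/
theorem exists_isMin_tpow {n k : ℕ} [Nonempty (Fin n)] (A : (Fin (k + 2) → Fin n) → ℝ) :
    ∃ (lam : ℝ) (x : Fin n → ℝ), (∀ i, 0 ≤ x i) ∧ 0 < ∑ i, x i ∧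
      tpow A x = lam * ∑ i, x i ^ (k + 2) ∧
      ∀ y : Fin n → ℝ, (∀ i, 0 ≤ y i) → 0 < ∑ i, y i →
        lam * ∑ i, y i ^ (k + 2) ≤ tpow A y := by
  have hpos (y : Fin n → ℝ) (hy : ∀ i, 0 ≤ y i) (hs : 0 < ∑ i, y i) :
      0 < ∑ i, y i ^ (k + 2) := by
    obtain ⟨i, -, hi⟩ := Finset.exists_lt_of_sum_lt (by simpa using hs :
      ∑ _i : Fin n, (0 : ℝ) < ∑ i, y i)
    exact Finset.sum_pos' (fun j _ => pow_nonneg (hy j) _) ⟨i, Finset.mem_univ i, pow_pos hi _⟩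
  obtain ⟨x, hx, hmin⟩ := (isCompact_stdSimplex ℝ (Fin n)).exists_isMinOn
    ⟨_, single_mem_stdSimplex ℝ (Classical.arbitrary (Fin n))⟩
    (f := fun x => tpow A x / ∑ i, x i ^ (k + 2))
    ((continuous_tpow A).continuousOn.div (by fun_prop)
      fun y hy => (hpos y hy.1 (by rw [hy.2]; exact one_pos)).ne')
  have hx1 : 0 < ∑ i, x i := by rw [hx.2]; exact one_pos
  refine ⟨_, x, hx.1, hx1, (div_mul_cancel₀ _ (hpos x hx.1 hx1).ne').symm, fun y hy hs => ?_⟩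
  rw [← le_div_iff₀ (hpos y hy hs)]
  have hmem : (∑ i, y i)⁻¹ • y ∈ stdSimplex ℝ (Fin n) :=
    ⟨fun i => mul_nonneg (inv_nonneg.2 hs.le) (hy i), by
      simp [← Finset.mul_sum, hs.ne']⟩
  refine (hmin hmem).trans_eq ?_
  have hc : (∑ i, y i)⁻¹ ^ (k + 2) ≠ 0 := pow_ne_zero _ (inv_ne_zero hs.ne')
  simp only [tpow_smul, Pi.smul_apply, smul_eq_mul, mul_pow (_ : ℝ)⁻¹, ← Finset.mul_sum]
  exact mul_div_mul_left _ _ hc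

/-- a symmetric tensor all of whose proper principal subtensors are
copositive fails to be copositive iff it has a negative H⁺⁺-eigenvalue. -/
theorem stmt_18 {n k : ℕ} (hn : 2 ≤ n) (A : (Fin (k + 2) → Fin n) → ℝ)
    (hsym : SymTensor A)
    (hsub : ∀ J : Finset (Fin n), J.Nonempty → J ≠ Finset.univ → CoposOn A J) :
    ¬ Copos A ↔
      ∃ lam : ℝ, lam < 0 ∧
        ∃ x : Fin n → ℝ, (∀ i, 0 < x i) ∧ ∀ i, tmul A x i = lam * x i ^ (k + 1) := by
  constructor
  · intro hA
    have : Nonempty (Fin n) := ⟨⟨0, by omega⟩⟩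
    obtain ⟨y, hy, hneg⟩ : ∃ y : Fin n → ℝ, (∀ i, 0 ≤ y i) ∧ tpow A y < 0 := by
      simpa [Copos] using hA
    obtain ⟨lam, x, hx, hxs, heq, hle⟩ := exists_isMin_tpow A
    have hys : 0 < ∑ i, y i := by
      refine (Finset.sum_nonneg fun i _ => hy i).lt_of_ne fun h => hneg.ne ?_
      have hy0 : y = (0 : ℝ) • y := by
        funext i
        simpa using (Finset.sum_eq_zero_iff_of_nonneg fun i _ => hy i).1 h.symm i
      rw [hy0, tpow_smul]
      simp
    have hlam : lam < 0 := by
      by_contra! h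
      exact ((mul_nonneg h (Finset.sum_nonneg fun i _ => pow_nonneg (hy i) (k + 2))).trans
        (hle y hy hys)).not_gt hneg
    obtain ⟨i₀, -, hi₀⟩ := Finset.exists_lt_of_sum_lt (by simpa using hxs :
      ∑ _i : Fin n, (0 : ℝ) < ∑ i, x i)
    have hxneg : tpow A x < 0 := by
      rw [heq]
      exact mul_neg_of_neg_of_pos hlam (Finset.sum_pos' (fun j _ => pow_nonneg (hx j) _)
        ⟨i₀, Finset.mem_univ _, pow_pos hi₀ _⟩)
    have hxpos : ∀ i, 0 < x i := by
      intro i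
      refine (hx i).lt_of_ne fun h => hxneg.not_ge ?_
      refine hsub {j | x j ≠ 0} ⟨i₀, by simp [hi₀.ne']⟩ (fun hJ => ?_) x hx (by simp)
      have := hJ ▸ Finset.mem_univ i
      simp [← h] at this
    refine ⟨lam, hlam, x, hxpos, fun i => ?_⟩
    have hpow : HasDerivAt
        (fun t : ℝ => ∑ l, (x + t • Pi.single i (1 : ℝ) : Fin n → ℝ) l ^ (k + 2))
        ((k + 2) * x i ^ (k + 1)) 0 :=
      (HasDerivAt.fun_sum fun l _ =>
        (hasDerivAt_add_smul_single x i l).fun_pow (k + 2)).congr_deriv (by simp [Pi.single_apply])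
    have hcont : Continuous fun t : ℝ => (x + t • Pi.single i 1 : Fin n → ℝ) := by fun_prop
    have hnear : ∀ᶠ t : ℝ in nhds 0, ∀ l, 0 < (x + t • Pi.single i (1 : ℝ) : Fin n → ℝ) l :=
      Filter.eventually_all.2 fun l =>
        ((continuous_apply l).comp hcont).continuousAt.eventually_const_lt
          (by simpa using hxpos l)
    have hloc : IsLocalMin (fun t : ℝ => tpow A (x + t • Pi.single i 1) -
        lam * ∑ l, (x + t • Pi.single i (1 : ℝ) : Fin n → ℝ) l ^ (k + 2)) 0 := by
      filter_upwards [hnear] with t ht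
      have := hle _ (fun l => (ht l).le) (Finset.sum_pos (fun l _ => ht l) Finset.univ_nonempty)
      simpa [heq] using this
    have hderiv := hloc.hasDerivAt_eq_zero ((hsym.hasDerivAt_tpow x i).sub (hpow.const_mul lam))
    have hk : (k + 2 : ℝ) ≠ 0 := by positivity
    refine mul_left_cancel₀ hk ?_
    linear_combination hderiv
  · rintro ⟨lam, hlam, x, hx, heig⟩ hA
    refine (hA x fun i => (hx i).le).not_gt ?_
    rw [tpow_eq_sum_mul_tmul]
    refine Finset.sum_neg (fun i _ => ?_) ⟨⟨0, by omega⟩, Finset.mem_univ _⟩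
    rw [heig]
    exact mul_neg_of_pos_of_neg (hx i) (mul_neg_of_neg_of_pos hlam (pow_pos (hx i) _))
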